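/- Let A be a transitive model of ZFC, ℚ ∈ A a forcing notion, M ≺ A with ℚ ∈ M (M not necessarily in A), and G an A-generic filter on ℚ. Define M[G] = { τ_G : τ ∈ M a ℚ-name } and M(G) = M[G] ∩ A. Then M(G)[G] = M[G]. -/

import Mathlib

open FirstOrder

namespace Paper

open scoped Classical

/-- Function symbols of the language: one unary symbol `U`. -/
inductive Funcs : ℕ → Type | U : Funcs 1

/-- Relation symbols of the language: one binary symbol `∈`. -/
inductive Rels : ℕ → Type | mem : Rels 2

/-- The language `ℒ` of set theory expanded by a unary function symbol `U`. -/
def L : Language := ⟨Funcs, Rels⟩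

/-- The `ℒ`-structure on a collection `A` of ZF-sets, interpreting `∈` as true membership
and the function symbol `U` by `u` (adjusted to be the identity where `u` leaves `A`). -/
noncomputable def zfStr (A : Set ZFSet) (u : ZFSet → ZFSet) : L.Structure ↥A where
  funMap {n} f v :=
    match f with
    | .U => if h : u (v 0 : ZFSet) ∈ A then ⟨u (v 0 : ZFSet), h⟩ else v 0
  RelMap {n} r v :=
    match r with
    | .mem => (v 0 : ZFSet) ∈ (v 1 : ZFSet)

/-- Satisfaction of a first-order `ℒ`-formula in the structure `(A, ∈, u)`. -/
noncomputable def Sat (A : Set ZFSet) (u : ZFSet → ZFSet) {n : ℕ}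
    (φ : L.Formula (Fin n)) (v : Fin n → ↥A) : Prop :=
  letI : L.Structure ↥A := zfStr A u
  φ.Realize v

/-- A collection of ZF-sets is transitive. -/
def IsTransitiveSet (A : Set ZFSet) : Prop := ∀ x ∈ A, ∀ y ∈ x, y ∈ A

/-- `x` is a (von Neumann) ordinal: a transitive set of transitive sets. -/
def IsOrd (x : ZFSet) : Prop := x.IsTransitive ∧ ∀ y ∈ x, ZFSet.IsTransitive y

/-- `M` is an elementary submodel of the structure `(A, ∈, u)`, via closure under the
interpretation of the symbols together with the Tarski–Vaught criterion. -/
structure IsElemSub (A : Set ZFSet) (u : ZFSet → ZFSet) (M : Set ZFSet) : Prop where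
  subset : M ⊆ A
  closedU : ∀ x ∈ M, u x ∈ M
  tv : ∀ (n : ℕ) (φ : L.Formula (Fin (n + 1))) (v : Fin n → ZFSet) (hv : ∀ i, v i ∈ M),
    (∃ a, ∃ ha : a ∈ A, Sat A u φ (Fin.cons ⟨a, ha⟩ fun i => ⟨v i, subset (hv i)⟩)) →
    ∃ a, ∃ haM : a ∈ M, Sat A u φ (Fin.cons ⟨a, subset haM⟩ fun i => ⟨v i, subset (hv i)⟩)

/-- The structure `(A, ∈, u)` satisfies ZFC: for a transitive carrier `A` (where
extensionality and foundation are automatic) this is the conjunction of pairing, union,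
power set, infinity, separation and replacement for first-order `ℒ`-formulas with
parameters, and choice. -/
structure SatZFC (A : Set ZFSet) (u : ZFSet → ZFSet) : Prop where
  pairing : ∀ x ∈ A, ∀ y ∈ A, ({x, y} : ZFSet) ∈ A
  union : ∀ x ∈ A, ZFSet.sUnion x ∈ A
  power : ∀ x ∈ A, ZFSet.sep (· ∈ A) (ZFSet.powerset x) ∈ A
  infinity : ZFSet.omega ∈ A
  separation : ∀ (n : ℕ) (φ : L.Formula (Fin (n + 1))) (v : Fin n → ↥A), ∀ x ∈ A,
    ZFSet.sep (fun z => ∃ h : z ∈ A, Sat A u φ (Fin.cons ⟨z, h⟩ v)) x ∈ A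
  replacement : ∀ (n : ℕ) (φ : L.Formula (Fin (n + 2))) (v : Fin n → ↥A), ∀ x ∈ A,
    (∀ z, ∀ h : z ∈ A, z ∈ x → ∃! w : ↥A, Sat A u φ (Fin.cons ⟨z, h⟩ (Fin.cons w v))) →
    ∃ b ∈ A, ∀ w, ∀ hw : w ∈ A,
      (w ∈ b ↔ ∃ z, ∃ h : z ∈ A, z ∈ x ∧ Sat A u φ (Fin.cons ⟨z, h⟩ (Fin.cons ⟨w, hw⟩ v)))
  choice : ∀ x ∈ A, (∀ y ∈ x, y ≠ (∅ : ZFSet)) →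
    ∃ f ∈ A, ∃ r, ZFSet.IsFunc x r f ∧ ∀ y ∈ x, ∀ z, ZFSet.pair y z ∈ f → z ∈ y

/-- An admissible structure `(A, ∈, u)`: `A` is transitive, `u` maps the ordinals of `A`
into `A`, and the structure satisfies ZFC in the expanded language. -/
structure Admissible (A : Set ZFSet) (u : ZFSet → ZFSet) : Prop where
  trans : IsTransitiveSet A
  ordMap : ∀ x ∈ A, IsOrd x → u x ∈ A
  zfc : SatZFC A u

/-- `A_α = A ∩ V_α`: the elements of `A` of rank below (the rank of) `α`. -/
def Ar (A : Set ZFSet) (α : ZFSet) : Set ZFSet := {x ∈ A | x.rank < α.rank}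

/-- `E_𝒜`: the set of ordinals `α ∈ A` such that `(A_α, ∈, u ↾ α)` is an elementary
submodel of `(A, ∈, u)`. -/
def Eset (A : Set ZFSet) (u : ZFSet → ZFSet) : Set ZFSet :=
  {α ∈ A | IsOrd α ∧ IsElemSub A u (Ar A α)}

/-- The supremum of the ranks of the members of a collection of ZF-sets. -/
noncomputable def osup (S : Set ZFSet) : Ordinal := sSup (ZFSet.rank '' S)

end Paper

namespace Paper

/-- The von Neumann natural number `n` as a ZF-set. -/
def natToZF : ℕ → ZFSet
  | 0 => ∅
  | n + 1 => insert (natToZF n) (natToZF n)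

/-- `t` is a finite tuple from `X`: a function whose domain is a natural number and whose
values lie in `X`; this codes the elements of `X^{<ω}`. -/
def IsFinTuple (X : Set ZFSet) (t : ZFSet) : Prop :=
  (∃ n : ℕ, ∃ r, ZFSet.IsFunc (natToZF n) r t) ∧
    ∀ i z : ZFSet, ZFSet.pair i z ∈ t → z ∈ X

/-- `f` is a (set) function. -/
def IsZFFun (f : ZFSet) : Prop := ∃ d r, ZFSet.IsFunc d r f

/-- `Hull(M, X)`: the set of all values `f(x̄)` where `f ∈ M` is a function and `x̄` is a
finite tuple from `X` lying in the domain of `f`. -/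
def Hull (M X : Set ZFSet) : Set ZFSet :=
  {z | ∃ f ∈ M, IsZFFun f ∧ ∃ t, IsFinTuple X t ∧ ZFSet.pair t z ∈ f}

/-- `A ∩ V_o` for an ordinal `o`: the elements of `A` of rank below `o`. -/
def ArO (A : Set ZFSet) (o : Ordinal) : Set ZFSet := {x ∈ A | x.rank < o}

end Paper

namespace Paper

open scoped Classical

/-- Well-foundedness of the rank order on ZF-sets. -/
theorem rankWf : WellFounded (fun a b : ZFSet => a.rank < b.rank) :=
  InvImage.wf ZFSet.rank wellFounded_lt

/-- The interpretation `τ_G` of a name `τ` by a filter `G`, defined by recursion: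
`val G τ = { val G σ : ∃ p ∈ G, (p, σ) ∈ τ }`. -/
noncomputable def val (G : Set ZFSet) : ZFSet → ZFSet :=
  rankWf.fix fun τ ih =>
    @ZFSet.image (fun σ => if h : σ.rank < τ.rank then ih σ h else ∅)
      (Classical.allZFSetDefinable _)
      (ZFSet.sep (fun σ => ∃ p ∈ G, ZFSet.pair p σ ∈ τ)
        (ZFSet.sUnion (ZFSet.sUnion τ)))

/-- `τ` is a `ℚ`-name: every element of `τ` is a pair `(p, σ)` with `p ∈ Q` and `σ` a
`ℚ`-name. -/
def IsName (Q : ZFSet) : ZFSet → Prop :=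
  rankWf.fix fun τ ih =>
    ∀ x ∈ τ, ∃ p σ, p ∈ Q ∧ x = ZFSet.pair p σ ∧ ∃ h : σ.rank < τ.rank, ih σ h

/-- `(Q, R)` is a forcing notion: `R ⊆ Q × Q` codes a preorder on `Q`
(`(p, q) ∈ R` meaning `p ≤ q`). -/
structure IsForcingPoset (Q R : ZFSet) : Prop where
  sub : R ⊆ Q.prod Q
  refl : ∀ p ∈ Q, ZFSet.pair p p ∈ R
  trans : ∀ p q r : ZFSet, ZFSet.pair p q ∈ R → ZFSet.pair q r ∈ R → ZFSet.pair p r ∈ R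

/-- `p ≤ q` in the forcing notion coded by `R`. -/
def leF (R p q : ZFSet) : Prop := ZFSet.pair p q ∈ R

/-- `D` is a dense subset of the forcing notion `(Q, R)`. -/
def DenseIn (Q R D : ZFSet) : Prop := D ⊆ Q ∧ ∀ p ∈ Q, ∃ q ∈ D.toSet, leF R q p

/-- `G` is an `A`-generic filter on the forcing notion `(Q, R)`: a filter meeting every
dense subset of `Q` that belongs to `A`. -/
structure IsGenericFilter (A : Set ZFSet) (Q R : ZFSet) (G : Set ZFSet) : Prop where
  sub : G ⊆ Q.toSet
  nonempty : G.Nonempty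
  upward : ∀ p ∈ G, ∀ q ∈ Q.toSet, leF R p q → q ∈ G
  directed : ∀ p ∈ G, ∀ q ∈ G, ∃ r ∈ G, leF R r p ∧ leF R r q
  generic : ∀ D : ZFSet, D ∈ A → DenseIn Q R D → ∃ p ∈ G, p ∈ D.toSet

/-- `M[G] = { τ_G : τ ∈ M a ℚ-name }`. -/
def extModel (G : Set ZFSet) (Q : ZFSet) (M : Set ZFSet) : Set ZFSet :=
  {z | ∃ τ ∈ M, IsName Q τ ∧ z = val G τ}

/-- `S ∩ ω₁`: the countable ordinals belonging to `S`. -/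
def ctblOrds (S : Set ZFSet) : Set ZFSet := {x ∈ S | IsOrd x ∧ x.toSet.Countable}

/-- `q` is `(M, ℚ)`-semigeneric: `q` forces `M[Ġ] ∩ ω₁ = M ∩ ω₁`, i.e. for every
`A`-generic filter `G` containing `q`, `M[G] ∩ ω₁ = M ∩ ω₁`. -/
def Semigeneric (A : Set ZFSet) (Q R q : ZFSet) (M : Set ZFSet) : Prop :=
  ∀ G : Set ZFSet, IsGenericFilter A Q R G → q ∈ G →
    ctblOrds (extModel G Q M) = ctblOrds M

end Paper

namespace Paper

universe u

section definability

variable {A : Set ZFSet.{u}} {B : Set ZFSet.{u}} {α : Type}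

/-- The membership symbol. -/
def memSym : L.Relations 2 := Rels.mem

/-- `t` is a variable or a parameter from `B`. -/
def Tm (B : Set ZFSet.{u}) (t : (α → ↥A) → ↥A) : Prop :=
  (∃ i, t = fun v => v i) ∨ ∃ b : ↥A, (b : ZFSet) ∈ B ∧ t = fun _ => b

theorem Tm.var (i : α) : Tm (A := A) B (fun v => v i) := Or.inl ⟨i, rfl⟩

theorem Tm.const {b : ↥A} (hb : (b : ZFSet) ∈ B) : Tm (A := A) (α := α) B (fun _ => b) :=
  Or.inr ⟨b, hb, rfl⟩

/-- `P` is definable over `(A, ∈)` with parameters from `B`. -/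
def Dfb (A B : Set ZFSet.{u}) (P : (α → ↥A) → Prop) : Prop :=
  ∃ (ι : Type) (_ : Finite ι) (w : ι → ↥A) (_ : ∀ i, (w i : ZFSet) ∈ B)
    (φ : L.Formula (ι ⊕ α)), ∀ v : α → ↥A,
      (@Language.Formula.Realize L ↥A (zfStr A id) _ φ (Sum.elim w v) ↔ P v)

theorem Dfb.congr {P P' : (α → ↥A) → Prop} (h : Dfb A B P) (e : ∀ v, P v ↔ P' v) :
    Dfb A B P' := by
  obtain ⟨ι, hι, w, hw, φ, hφ⟩ := h
  exact ⟨ι, hι, w, hw, φ, fun v => (hφ v).trans (e v)⟩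

theorem Dfb.not {P : (α → ↥A) → Prop} (h : Dfb A B P) : Dfb A B (fun v => ¬ P v) := by
  obtain ⟨ι, hι, w, hw, φ, hφ⟩ := h
  refine ⟨ι, hι, w, hw, φ.not, fun v => ?_⟩
  let _ := zfStr A id
  rw [Language.Formula.realize_not]
  exact not_congr (hφ v)

theorem Dfb.and {P P' : (α → ↥A) → Prop} (h : Dfb A B P) (h' : Dfb A B P') :
    Dfb A B (fun v => P v ∧ P' v) := by
  obtain ⟨ι, hι, w, hw, φ, hφ⟩ := h
  obtain ⟨κ, hκ, w', hw', ψ, hψ⟩ := h'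
  refine ⟨ι ⊕ κ, inferInstance, Sum.elim w w', ?_,
    (φ.relabel (Sum.map Sum.inl id)) ⊓ (ψ.relabel (Sum.map Sum.inr id)), fun v => ?_⟩
  · rintro (i | i)
    · exact hw i
    · exact hw' i
  · let _ := zfStr A id
    change _ ↔ P v ∧ P' v
    rw [Language.Formula.realize_inf, Language.Formula.realize_relabel,
      Language.Formula.realize_relabel, ← hφ v, ← hψ v]
    have e1 : (Sum.elim (Sum.elim w w') v ∘ Sum.map Sum.inl id) = Sum.elim w v := by
      funext x; rcases x with x | x <;> rfl
    have e2 : (Sum.elim (Sum.elim w w') v ∘ Sum.map Sum.inr id) = Sum.elim w' v := by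
      funext x; rcases x with x | x <;> rfl
    rw [e1, e2]

theorem Dfb.or {P P' : (α → ↥A) → Prop} (h : Dfb A B P) (h' : Dfb A B P') :
    Dfb A B (fun v => P v ∨ P' v) :=
  (h.not.and h'.not).not.congr fun v => by tauto

theorem Dfb.imp {P P' : (α → ↥A) → Prop} (h : Dfb A B P) (h' : Dfb A B P') :
    Dfb A B (fun v => P v → P' v) :=
  (h.and h'.not).not.congr fun v => by tauto

theorem Dfb.iff {P P' : (α → ↥A) → Prop} (h : Dfb A B P) (h' : Dfb A B P') :
    Dfb A B (fun v => P v ↔ P' v) :=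
  ((h.imp h').and (h'.imp h)).congr fun v => by tauto

theorem Dfb.ex {P : (α → ↥A) → ↥A → Prop}
    (h : Dfb (α := Option α) A B (fun v => P (fun i => v (some i)) (v none))) :
    Dfb A B (fun v => ∃ a, P v a) := by
  obtain ⟨ι, hι, w, hw, φ, hφ⟩ := h
  refine ⟨ι, hι, w, hw, (φ.relabel (β := (ι ⊕ α) ⊕ Unit)
    (Sum.elim (fun i => Sum.inl (Sum.inl i))
      (fun o => o.elim (Sum.inr ()) (fun i => Sum.inl (Sum.inr i))))).iExs Unit, fun v => ?_⟩
  let _ := zfStr A id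
  rw [Language.Formula.realize_iExs]
  have key : ∀ (i : Unit → ↥A), (Sum.elim (Sum.elim w v) i ∘
      (Sum.elim (fun i => Sum.inl (Sum.inl i))
      (fun o => o.elim (Sum.inr ()) (fun i => Sum.inl (Sum.inr i))))) =
      Sum.elim w (fun o : Option α => o.elim (i ()) v) := by
    intro i
    funext x; rcases x with x | (_ | x) <;> rfl
  constructor
  · rintro ⟨i, hi⟩
    rw [Language.Formula.realize_relabel, key, hφ] at hi
    exact ⟨_, hi⟩
  · rintro ⟨a, ha⟩
    refine ⟨fun _ => a, ?_⟩
    rw [Language.Formula.realize_relabel, key, hφ]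
    exact ha

theorem Dfb.all {P : (α → ↥A) → ↥A → Prop}
    (h : Dfb (α := Option α) A B (fun v => P (fun i => v (some i)) (v none))) :
    Dfb A B (fun v => ∀ a, P v a) :=
  (Dfb.ex (P := fun v a => ¬ P v a) h.not).not.congr fun v => by simp

theorem Tm.toTerm {t : (α → ↥A) → ↥A} (h : Tm B t) :
    ∃ (ι : Type) (_ : Finite ι) (w : ι → ↥A) (_ : ∀ i, (w i : ZFSet) ∈ B)
    (j : ι ⊕ α), ∀ v : α → ↥A, Sum.elim w v j = t v := by
  rcases h with ⟨i, rfl⟩ | ⟨b, hb, rfl⟩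
  · exact ⟨Empty, inferInstance, Empty.elim, fun i => i.elim, Sum.inr i, fun v => rfl⟩
  · exact ⟨Unit, inferInstance, fun _ => b, fun _ => hb, Sum.inl (), fun v => rfl⟩

theorem Dfb.mem {t s : (α → ↥A) → ↥A} (ht : Tm B t) (hs : Tm B s) :
    Dfb A B (fun v => (t v : ZFSet) ∈ (s v : ZFSet)) := by
  obtain ⟨ι, hι, w, hw, j, hj⟩ := ht.toTerm
  obtain ⟨κ, hκ, w', hw', k, hk⟩ := hs.toTerm
  refine ⟨ι ⊕ κ, inferInstance, Sum.elim w w', ?_,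
    Language.Relations.formula₂ memSym
      (Language.Term.var (Sum.map Sum.inl id j)) (Language.Term.var (Sum.map Sum.inr id k)),
    fun v => ?_⟩
  · rintro (i | i)
    · exact hw i
    · exact hw' i
  · let _ := zfStr A id
    change _ ↔ (t v : ZFSet) ∈ (s v : ZFSet)
    rw [Language.Formula.realize_rel₂, ← hj v, ← hk v]
    have e1 : Sum.elim (Sum.elim w w') v (Sum.map Sum.inl id j) = Sum.elim w v j := by
      rcases j with x | x <;> rfl
    have e2 : Sum.elim (Sum.elim w w') v (Sum.map Sum.inr id k) = Sum.elim w' v k := by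
      rcases k with x | x <;> rfl
    rw [Language.Term.realize_var, Language.Term.realize_var, e1, e2]
    rfl

theorem Dfb.subst {β : Type} [Finite β] {P : (β → ↥A) → Prop} (h : Dfb A B P)
    {t : β → (α → ↥A) → ↥A} (ht : ∀ i, Tm B (t i)) : Dfb A B (fun v => P (fun i => t i v)) := by
  obtain ⟨ι, hι, w, hw, φ, hφ⟩ := h
  choose κ hκ w' hw' j hj using fun i => (ht i).toTerm
  refine ⟨ι ⊕ (Σ i, κ i), inferInstance, Sum.elim w (fun x => w' x.1 x.2), ?_,
    φ.relabel (Sum.elim (fun i => Sum.inl (Sum.inl i))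
      (fun i => Sum.map (fun x => Sum.inr ⟨i, x⟩) id (j i))), fun v => ?_⟩
  · rintro (i | i)
    · exact hw i
    · exact hw' _ _
  · let _ := zfStr A id
    change _ ↔ P (fun i => t i v)
    rw [Language.Formula.realize_relabel, ← hφ]
    have e1 : (Sum.elim (Sum.elim w (fun x : (Σ i, κ i) => w' x.1 x.2)) v ∘
        (Sum.elim (fun i => Sum.inl (Sum.inl i))
        (fun i => Sum.map (fun x => Sum.inr ⟨i, x⟩) id (j i)))) =
        Sum.elim w (fun i => t i v) := by
      funext x
      rcases x with x | x
      · rfl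
      · simp only [Function.comp_apply, Sum.elim_inr]
        rw [← hj x v]
        rcases j x with y | y <;> rfl
    rw [e1]

theorem Dfb.sub1 {P : ↥A → Prop} (h : Dfb (α := Fin 1) A B (fun v => P (v 0)))
    {t : (α → ↥A) → ↥A} (ht : Tm B t) : Dfb A B (fun v => P (t v)) :=
  h.subst (t := ![t]) (by intro i; fin_cases i; exact ht)

theorem Dfb.sub2 {P : ↥A → ↥A → Prop} (h : Dfb (α := Fin 2) A B (fun v => P (v 0) (v 1)))
    {t s : (α → ↥A) → ↥A} (ht : Tm B t) (hs : Tm B s) : Dfb A B (fun v => P (t v) (s v)) :=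
  h.subst (t := ![t, s]) (by intro i; fin_cases i; exacts [ht, hs])

theorem Dfb.sub3 {P : ↥A → ↥A → ↥A → Prop}
    (h : Dfb (α := Fin 3) A B (fun v => P (v 0) (v 1) (v 2)))
    {t s r : (α → ↥A) → ↥A} (ht : Tm B t) (hs : Tm B s) (hr : Tm B r) :
    Dfb A B (fun v => P (t v) (s v) (r v)) :=
  h.subst (t := ![t, s, r]) (by intro i; fin_cases i; exacts [ht, hs, hr])

theorem Dfb.sub4 {P : ↥A → ↥A → ↥A → ↥A → Prop}
    (h : Dfb (α := Fin 4) A B (fun v => P (v 0) (v 1) (v 2) (v 3)))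
    {t s r q : (α → ↥A) → ↥A} (ht : Tm B t) (hs : Tm B s) (hr : Tm B r) (hq : Tm B q) :
    Dfb A B (fun v => P (t v) (s v) (r v) (q v)) :=
  h.subst (t := ![t, s, r, q]) (by intro i; fin_cases i; exacts [ht, hs, hr, hq])

/-- Extraction of a formula over `Fin` from a definable predicate. -/
theorem Dfb.extract {k : ℕ} {P : (Fin k → ↥A) → Prop} (h : Dfb A B P) :
    ∃ (n : ℕ) (w : Fin n → ↥A) (_ : ∀ i, (w i : ZFSet) ∈ B) (φ : L.Formula (Fin n ⊕ Fin k)),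
      ∀ v : Fin k → ↥A,
      (@Language.Formula.Realize L ↥A (zfStr A id) _ φ (Sum.elim w v) ↔ P v) := by
  obtain ⟨ι, hι, w, hw, φ, hφ⟩ := h
  obtain ⟨n, ⟨e⟩⟩ := Finite.exists_equiv_fin ι
  refine ⟨n, w ∘ e.symm, fun i => hw _, φ.relabel (Sum.map e id), fun v => ?_⟩
  let _ := zfStr A id
  rw [Language.Formula.realize_relabel, ← hφ v]
  have e1 : (Sum.elim (w ∘ e.symm) v ∘ Sum.map e id) = Sum.elim w v := by
    funext x; rcases x with x | x <;> simp
  rw [e1]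

theorem Dfb.extract1 {P : ↥A → Prop} (h : Dfb (α := Fin 1) A B (fun v => P (v 0))) :
    ∃ (n : ℕ) (w : Fin n → ↥A) (_ : ∀ i, (w i : ZFSet) ∈ B) (φ : L.Formula (Fin (n + 1))),
      ∀ z : ↥A, (Sat A id φ (Fin.cons z w) ↔ P z) := by
  obtain ⟨n, w, hw, φ, hφ⟩ := h.extract
  refine ⟨n, w, hw, φ.relabel (Sum.elim Fin.succ (fun _ => 0)), fun z => ?_⟩
  let _ := zfStr A id
  rw [← hφ (fun _ => z)]
  refine Language.Formula.realize_relabel.trans ?_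
  have e1 : ((Fin.cons z w : Fin (n+1) → ↥A) ∘ Sum.elim Fin.succ (fun _ => 0))
      = Sum.elim w (fun _ : Fin 1 => z) := by
    funext x; rcases x with x | x <;> simp
  rw [e1]

theorem Dfb.extract2 {P : ↥A → ↥A → Prop}
    (h : Dfb (α := Fin 2) A B (fun v => P (v 0) (v 1))) :
    ∃ (n : ℕ) (w : Fin n → ↥A) (_ : ∀ i, (w i : ZFSet) ∈ B) (φ : L.Formula (Fin (n + 2))),
      ∀ z y : ↥A, (Sat A id φ (Fin.cons z (Fin.cons y w)) ↔ P z y) := by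
  obtain ⟨n, w, hw, φ, hφ⟩ := h.extract
  refine ⟨n, w, hw, φ.relabel (Sum.elim (fun i => i.succ.succ) ![0, 1]), fun z y => ?_⟩
  let _ := zfStr A id
  have := hφ ![z, y]
  simp only [Matrix.cons_val_zero, Matrix.cons_val_one] at this
  rw [← this]
  refine Language.Formula.realize_relabel.trans ?_
  have e1 : ((Fin.cons z (Fin.cons y w : Fin (n+1) → ↥A) : Fin (n+2) → ↥A) ∘
      Sum.elim (fun i => i.succ.succ) ![0, 1]) = Sum.elim w ![z, y] := by
    funext x; rcases x with x | x
    · simp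
    · fin_cases x <;> rfl
  rw [e1]

/-- Separation. -/
theorem sepA (hZ : SatZFC A id) {P : ↥A → Prop}
    (h : Dfb (α := Fin 1) A Set.univ (fun v => P (v 0))) (x : ↥A) :
    ∃ y : ↥A, ∀ z : ↥A, z.1 ∈ y.1 ↔ z.1 ∈ x.1 ∧ P z := by
  obtain ⟨n, w, -, φ, hφ⟩ := h.extract1
  refine ⟨⟨_, hZ.separation n φ w x.1 x.2⟩, fun z => ?_⟩
  rw [ZFSet.mem_sep]
  refine and_congr_right fun _ => ⟨fun ⟨_, h⟩ => (hφ _).1 h, fun h => ⟨z.2, (hφ _).2 h⟩⟩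

/-- Elementarity. -/
theorem elemA {M : Set ZFSet.{u}} (hM : IsElemSub A id M) {P : ↥A → Prop}
    (h : Dfb (α := Fin 1) A M (fun v => P (v 0))) (hex : ∃ a, P a) :
    ∃ a : ↥A, a.1 ∈ M ∧ P a := by
  obtain ⟨n, w, hw, φ, hφ⟩ := h.extract1
  obtain ⟨a, ha⟩ := hex
  obtain ⟨b, hb, hs⟩ := hM.tv n φ (fun i => (w i).1) hw ⟨a.1, a.2, (hφ a).2 ha⟩
  exact ⟨⟨b, hM.subset hb⟩, hb, (hφ _).1 hs⟩

end definability

end Paper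

namespace Paper

universe u

section closure

variable {A : Set ZFSet.{u}} {B : Set ZFSet.{u}} {α : Type}

theorem extA (hT : IsTransitiveSet A) {x y : ↥A} (h : ∀ z : ↥A, z.1 ∈ x.1 ↔ z.1 ∈ y.1) :
    x = y := by
  apply Subtype.ext
  ext z
  exact ⟨fun hz => (h ⟨z, hT _ x.2 _ hz⟩).1 hz, fun hz => (h ⟨z, hT _ y.2 _ hz⟩).2 hz⟩

theorem Dfb.eq (hT : IsTransitiveSet A) {t s : (α → ↥A) → ↥A} (ht : Tm B t) (hs : Tm B s) :
    Dfb A B (fun v => t v = s v) := by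
  refine Dfb.sub2 (P := fun x y => x = y) ?_ ht hs
  refine Dfb.congr (P := fun v : Fin 2 → ↥A => ∀ z : ↥A, z.1 ∈ (v 0).1 ↔ z.1 ∈ (v 1).1) ?_ ?_
  · exact Dfb.all ((Dfb.mem (Tm.var _) (Tm.var _)).iff (Dfb.mem (Tm.var _) (Tm.var _)))
  · intro v
    exact ⟨extA hT, fun h z => by rw [h]⟩

/-- The unordered pair in `A`. -/
def upA (hZ : SatZFC A id) (x y : ↥A) : ↥A := ⟨{x.1, y.1}, hZ.pairing _ x.2 _ y.2⟩

theorem mem_upA (hZ : SatZFC A id) (x y z : ↥A) : z.1 ∈ (upA hZ x y).1 ↔ z = x ∨ z = y := by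
  simp [upA, ZFSet.mem_pair, Subtype.ext_iff]

/-- The ordered pair in `A`. -/
def prA (hZ : SatZFC A id) (x y : ↥A) : ↥A :=
  ⟨ZFSet.pair x.1 y.1, by
    have := (upA hZ (upA hZ x x) (upA hZ x y)).2
    simpa [upA, ZFSet.pair] using this⟩

theorem prA_eq (hZ : SatZFC A id) (x y : ↥A) : prA hZ x y = upA hZ (upA hZ x x) (upA hZ x y) := by
  apply Subtype.ext
  simp [upA, prA, ZFSet.pair]

theorem prA_inj (hZ : SatZFC A id) {x y x' y' : ↥A} (h : prA hZ x y = prA hZ x' y') :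
    x = x' ∧ y = y' := by
  have := ZFSet.pair_inj.1 (congrArg Subtype.val h)
  exact ⟨Subtype.ext this.1, Subtype.ext this.2⟩

theorem Dfb.isUp (hT : IsTransitiveSet A) (hZ : SatZFC A id) {t s r : (α → ↥A) → ↥A}
    (ht : Tm B t) (hs : Tm B s) (hr : Tm B r) :
    Dfb A B (fun v => t v = upA hZ (s v) (r v)) := by
  refine Dfb.sub3 (P := fun x y z => x = upA hZ y z) ?_ ht hs hr
  refine Dfb.congr (P := fun v : Fin 3 → ↥A => ∀ z : ↥A, z.1 ∈ (v 0).1 ↔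
    (z = v 1 ∨ z = v 2)) ?_ ?_
  · exact Dfb.all ((Dfb.mem (Tm.var _) (Tm.var _)).iff
      ((Dfb.eq hT (Tm.var _) (Tm.var _)).or (Dfb.eq hT (Tm.var _) (Tm.var _))))
  · intro v
    constructor
    · intro h
      exact extA hT fun z => by rw [h z, mem_upA]
    · intro h z
      rw [h, mem_upA]

theorem Dfb.isPr (hT : IsTransitiveSet A) (hZ : SatZFC A id) {t s r : (α → ↥A) → ↥A}
    (ht : Tm B t) (hs : Tm B s) (hr : Tm B r) :
    Dfb A B (fun v => t v = prA hZ (s v) (r v)) := by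
  refine Dfb.sub3 (P := fun x y z => x = prA hZ y z) ?_ ht hs hr
  refine Dfb.congr (P := fun v : Fin 3 → ↥A => ∃ z w : ↥A, z = upA hZ (v 1) (v 1) ∧
    w = upA hZ (v 1) (v 2) ∧ v 0 = upA hZ z w) ?_ ?_
  · exact Dfb.ex (Dfb.ex ((Dfb.isUp hT hZ (Tm.var _) (Tm.var _) (Tm.var _)).and
      ((Dfb.isUp hT hZ (Tm.var _) (Tm.var _) (Tm.var _)).and
        (Dfb.isUp hT hZ (Tm.var _) (Tm.var _) (Tm.var _)))))
  · intro v
    simp [prA_eq]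

theorem Dfb.prmem (hT : IsTransitiveSet A) (hZ : SatZFC A id) {t s r : (α → ↥A) → ↥A}
    (ht : Tm B t) (hs : Tm B s) (hr : Tm B r) :
    Dfb A B (fun v => (prA hZ (t v) (s v)).1 ∈ (r v).1) := by
  refine Dfb.sub3 (P := fun x y z => (prA hZ x y).1 ∈ z.1) ?_ ht hs hr
  refine Dfb.congr (P := fun v : Fin 3 → ↥A => ∃ z : ↥A, z = prA hZ (v 0) (v 1) ∧
    z.1 ∈ (v 2).1) ?_ ?_
  · exact Dfb.ex ((Dfb.isPr hT hZ (Tm.var _) (Tm.var _) (Tm.var _)).and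
      (Dfb.mem (Tm.var _) (Tm.var _)))
  · intro v
    simp

theorem Dfb.trmem (hT : IsTransitiveSet A) (hZ : SatZFC A id) {t s r q : (α → ↥A) → ↥A}
    (ht : Tm B t) (hs : Tm B s) (hr : Tm B r) (hq : Tm B q) :
    Dfb A B (fun v => (prA hZ (t v) (prA hZ (s v) (r v))).1 ∈ (q v).1) := by
  refine Dfb.sub4 (P := fun x y z w => (prA hZ x (prA hZ y z)).1 ∈ w.1) ?_ ht hs hr hq
  refine Dfb.congr (P := fun v : Fin 4 → ↥A => ∃ z : ↥A, z = prA hZ (v 1) (v 2) ∧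
    (prA hZ (v 0) z).1 ∈ (v 3).1) ?_ ?_
  · exact Dfb.ex ((Dfb.isPr hT hZ (Tm.var _) (Tm.var _) (Tm.var _)).and
      (Dfb.prmem hT hZ (Tm.var _) (Tm.var _) (Tm.var _)))
  · intro v
    simp

/-- Unions in `A`. -/
def unA (hZ : SatZFC A id) (x : ↥A) : ↥A := ⟨ZFSet.sUnion x.1, hZ.union _ x.2⟩

theorem mem_unA (hZ : SatZFC A id) {x y z : ↥A} (h : z.1 ∈ y.1) (h' : y.1 ∈ x.1) :
    z.1 ∈ (unA hZ x).1 := ZFSet.mem_sUnion.2 ⟨y.1, h', h⟩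

theorem mem_unA_iff (hT : IsTransitiveSet A) (hZ : SatZFC A id) {x z : ↥A} :
    z.1 ∈ (unA hZ x).1 ↔ ∃ y : ↥A, y.1 ∈ x.1 ∧ z.1 ∈ y.1 := by
  constructor
  · intro h
    obtain ⟨y, hy, hz⟩ := ZFSet.mem_sUnion.1 h
    exact ⟨⟨y, hT _ x.2 _ hy⟩, hy, hz⟩
  · rintro ⟨y, hy, hz⟩
    exact mem_unA hZ hz hy

theorem insA (hT : IsTransitiveSet A) (hZ : SatZFC A id) (a x : ↥A) :
    ∃ y : ↥A, ∀ z : ↥A, z.1 ∈ y.1 ↔ z = a ∨ z.1 ∈ x.1 := by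
  refine ⟨unA hZ (upA hZ (upA hZ a a) x), fun z => ?_⟩
  rw [mem_unA_iff hT]
  simp only [mem_upA]
  constructor
  · rintro ⟨y, rfl | rfl, h⟩
    · rw [mem_upA] at h; tauto
    · exact Or.inr h
  · rintro (h | h)
    · exact ⟨_, Or.inl rfl, by rw [mem_upA]; tauto⟩
    · exact ⟨_, Or.inr rfl, h⟩

theorem prodA (hT : IsTransitiveSet A) (hZ : SatZFC A id) (X Y : ↥A) :
    ∃ P : ↥A, ∀ x y : ↥A, x.1 ∈ X.1 → y.1 ∈ Y.1 → (prA hZ x y).1 ∈ P.1 := by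
  have pow : ∀ x : ↥A, ∃ y : ↥A, ∀ z : ↥A, (∀ w : ↥A, w.1 ∈ z.1 → w.1 ∈ x.1) → z.1 ∈ y.1 := by
    intro x
    refine ⟨⟨_, hZ.power _ x.2⟩, fun z hz => ?_⟩
    rw [ZFSet.mem_sep, ZFSet.mem_powerset]
    exact ⟨fun w hw => hz ⟨w, hT _ z.2 _ hw⟩ hw, z.2⟩
  obtain ⟨P1, h1⟩ := pow (unA hZ (upA hZ X Y))
  obtain ⟨P2, h2⟩ := pow P1
  refine ⟨P2, fun x y hx hy => ?_⟩
  have hx' : x.1 ∈ (unA hZ (upA hZ X Y)).1 := mem_unA hZ hx ((mem_upA _ _ _ _).2 (Or.inl rfl))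
  have hy' : y.1 ∈ (unA hZ (upA hZ X Y)).1 := mem_unA hZ hy ((mem_upA _ _ _ _).2 (Or.inr rfl))
  apply h2
  intro w hw
  rw [prA_eq, mem_upA] at hw
  apply h1
  intro c hc
  rcases hw with rfl | rfl <;> rw [mem_upA] at hc <;> rcases hc with rfl | rfl <;> assumption

/-- Replacement for partial definable functions. -/
theorem repA (hZ : SatZFC A id) {P : ↥A → ↥A → Prop}
    (h : Dfb (α := Fin 2) A Set.univ (fun v => P (v 0) (v 1))) (x : ↥A)
    (hu : ∀ z w w' : ↥A, z.1 ∈ x.1 → P z w → P z w' → w = w') :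
    ∃ y : ↥A, ∀ w : ↥A, w.1 ∈ y.1 ↔ ∃ z : ↥A, z.1 ∈ x.1 ∧ P z w := by
  have hd : Dfb (α := Fin 1) A Set.univ (fun v => ∃ w, P (v 0) w) :=
    Dfb.ex (h.sub2 (Tm.var _) (Tm.var _))
  obtain ⟨x', hx'⟩ := sepA hZ (P := fun z => ∃ w, P z w) hd x
  obtain ⟨n, w, -, φ, hφ⟩ := h.extract2
  obtain ⟨b, hb, hb'⟩ := hZ.replacement n φ w x'.1 x'.2 (by
    intro z hz hzx
    obtain ⟨h1, c, hc⟩ := (hx' ⟨z, hz⟩).1 hzx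
    refine ⟨c, (hφ _ _).2 hc, fun d hd => hu _ _ _ h1 ((hφ _ _).1 hd) hc⟩)
  refine ⟨⟨b, hb⟩, fun c => ?_⟩
  rw [hb' c.1 c.2]
  constructor
  · rintro ⟨z, hz, hzx, hs⟩
    exact ⟨⟨z, hz⟩, ((hx' ⟨z, hz⟩).1 hzx).1, (hφ _ _).1 hs⟩
  · rintro ⟨z, hz, hp⟩
    exact ⟨z.1, z.2, (hx' z).2 ⟨hz, c, hp⟩, (hφ _ _).2 hp⟩

/-- `t` is transitive. -/
def TrA (t : ↥A) : Prop := ∀ y : ↥A, y.1 ∈ t.1 → ∀ z : ↥A, z.1 ∈ y.1 → z.1 ∈ t.1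

theorem Dfb.tr {t : (α → ↥A) → ↥A} (ht : Tm B t) : Dfb A B (fun v => TrA (t v)) := by
  refine Dfb.sub1 (P := fun x => TrA x) ?_ ht
  unfold TrA
  exact Dfb.all ((Dfb.mem (Tm.var _) (Tm.var _)).imp (Dfb.all ((Dfb.mem (Tm.var _)
    (Tm.var _)).imp (Dfb.mem (Tm.var _) (Tm.var _)))))

/-- `∈`-induction for `A`. -/
theorem indA (hT : IsTransitiveSet A) {P : ↥A → Prop}
    (h : ∀ x : ↥A, (∀ y : ↥A, y.1 ∈ x.1 → P y) → P x) (x : ↥A) : P x := by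
  obtain ⟨x, hx⟩ := x
  induction x using ZFSet.inductionOn with
  | h x ih => exact h _ fun y hy => ih y.1 hy y.2

/-- `t` is the least transitive set with `x` in it. -/
def TcA (x t : ↥A) : Prop :=
  TrA t ∧ x.1 ∈ t.1 ∧ ∀ t' : ↥A, TrA t' → x.1 ∈ t'.1 → ∀ z : ↥A, z.1 ∈ t.1 → z.1 ∈ t'.1

theorem tcA (hT : IsTransitiveSet A) (hZ : SatZFC A id) (x : ↥A) :
    ∃ t : ↥A, TrA t ∧ x.1 ∈ t.1 := by
  suffices h : ∃ t, TcA x t from by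
    obtain ⟨t, h1, h2, -⟩ := h
    exact ⟨t, h1, h2⟩
  induction x using indA hT with
  | h x ih =>
  have hd : Dfb (α := Fin 2) A Set.univ (fun v => TcA (v 0) (v 1)) := by
    unfold TcA
    exact (Dfb.tr (Tm.var _)).and ((Dfb.mem (Tm.var _) (Tm.var _)).and
      (Dfb.all ((Dfb.tr (Tm.var _)).imp ((Dfb.mem (Tm.var _) (Tm.var _)).imp
        (Dfb.all ((Dfb.mem (Tm.var _) (Tm.var _)).imp (Dfb.mem (Tm.var _) (Tm.var _))))))))
  obtain ⟨b, hb⟩ := repA hZ hd x (by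
    rintro z w w' - ⟨h1, h2, h3⟩ ⟨h1', h2', h3'⟩
    exact extA hT fun c => ⟨h3 _ h1' h2' _, h3' _ h1 h2 _⟩)
  obtain ⟨t, ht⟩ := insA hT hZ x (unA hZ b)
  refine ⟨t, ?_, (ht x).2 (Or.inl rfl), ?_⟩
  · intro y hy z hz
    rw [ht] at hy ⊢
    right
    rw [mem_unA_iff hT] at hy ⊢
    rcases hy with rfl | ⟨c, hc, hyc⟩
    · obtain ⟨c, hc⟩ := ih z hz
      exact ⟨c, (hb c).2 ⟨z, hz, hc⟩, hc.2.1⟩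
    · obtain ⟨d, -, hdc⟩ := (hb c).1 hc
      exact ⟨c, hc, hdc.1 y hyc z hz⟩
  · intro t' h1 h2 z hz
    rw [ht, mem_unA_iff hT] at hz
    rcases hz with rfl | ⟨c, hc, hzc⟩
    · exact h2
    · obtain ⟨d, hd, hdc⟩ := (hb c).1 hc
      exact hdc.2.2 t' h1 (h1 x h2 d hd) z hzc

/-- The second coordinate of a pair in a set. -/
theorem snd_mem (hZ : SatZFC A id) {x y t : ↥A} (h : (prA hZ x y).1 ∈ t.1) :
    y.1 ∈ (unA hZ (unA hZ t)).1 := by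
  refine mem_unA hZ (y := upA hZ x y) ((mem_upA _ _ _ _).2 (Or.inr rfl)) ?_
  refine mem_unA hZ (y := prA hZ x y) ?_ h
  rw [prA_eq, mem_upA]
  exact Or.inr rfl

theorem TrA.pr (hZ : SatZFC A id) {x y t τ : ↥A} (ht : TrA t) (hτ : τ.1 ∈ t.1)
    (h : (prA hZ x y).1 ∈ τ.1) : y.1 ∈ t.1 := by
  have h1 := ht _ hτ _ h
  have h2 : (upA hZ x y).1 ∈ t.1 := by
    refine ht _ h1 _ ?_
    rw [prA_eq, mem_upA]
    exact Or.inr rfl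
  exact ht _ h2 _ ((mem_upA _ _ _ _).2 (Or.inr rfl))

end closure

end Paper

namespace Paper

universe u

section forcing

variable {A : Set ZFSet.{u}} {B : Set ZFSet.{u}} {α : Type}

/-- One step of the recursion defining `p ⊩ τ = ǎ`. -/
def Stp (hZ : SatZFC A id) (R : ↥A) (T : ↥A → ↥A → ↥A → Prop) (p τ a : ↥A) : Prop :=
  (∀ b : ↥A, b.1 ∈ a.1 → ∀ q : ↥A, (prA hZ q p).1 ∈ R.1 →
    ∃ q' : ↥A, (prA hZ q' q).1 ∈ R.1 ∧ ∃ r σ : ↥A, (prA hZ r σ).1 ∈ τ.1 ∧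
      (prA hZ q' r).1 ∈ R.1 ∧ T q' σ b) ∧
  (∀ r σ : ↥A, (prA hZ r σ).1 ∈ τ.1 → ∀ q : ↥A, (prA hZ q p).1 ∈ R.1 →
    (prA hZ q r).1 ∈ R.1 → ∃ q' : ↥A, (prA hZ q' q).1 ∈ R.1 ∧ ∃ b : ↥A, b.1 ∈ a.1 ∧ T q' σ b)

/-- `X` is a set of triples justified by the recursion. -/
def Att (hZ : SatZFC A id) (Q R X : ↥A) : Prop :=
  ∀ p τ a : ↥A, (prA hZ p (prA hZ τ a)).1 ∈ X.1 → p.1 ∈ Q.1 ∧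
    Stp hZ R (fun p τ a => (prA hZ p (prA hZ τ a)).1 ∈ X.1) p τ a

/-- The forcing relation `p ⊩ τ = ǎ`. -/
def Fo (hZ : SatZFC A id) (Q R p τ a : ↥A) : Prop :=
  ∃ X : ↥A, Att hZ Q R X ∧ (prA hZ p (prA hZ τ a)).1 ∈ X.1

theorem Dfb.fo (hT : IsTransitiveSet A) (hZ : SatZFC A id) {Q R : ↥A} (hQ : Q.1 ∈ B)
    (hR : R.1 ∈ B) {t s r : (α → ↥A) → ↥A}
    (ht : Tm B t) (hs : Tm B s) (hr : Tm B r) :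
    Dfb A B (fun v => Fo hZ Q R (t v) (s v) (r v)) := by
  refine Dfb.sub3 (P := fun x y z => Fo hZ Q R x y z) ?_ ht hs hr
  unfold Fo Att Stp
  repeat' first
    | with_reducible exact Tm.var _
    | with_reducible exact Tm.const hQ
    | with_reducible exact Tm.const hR
    | with_reducible apply Dfb.trmem hT
    | with_reducible apply Dfb.prmem hT
    | with_reducible apply Dfb.mem
    | with_reducible apply Dfb.and
    | with_reducible apply Dfb.ex
    | with_reducible apply Dfb.all
    | with_reducible apply Dfb.imp

theorem Stp.mono {hZ : SatZFC A id} {R : ↥A} {T T' : ↥A → ↥A → ↥A → Prop} {p τ a : ↥A}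
    (h : Stp hZ R T p τ a) (hTT : ∀ q r σ b : ↥A, (prA hZ r σ).1 ∈ τ.1 → b.1 ∈ a.1 →
      T q σ b → T' q σ b) : Stp hZ R T' p τ a := by
  refine ⟨fun b hb q hq => ?_, fun r σ h1 q h2 h3 => ?_⟩
  · obtain ⟨q', h1, r, σ, h2, h3, h4⟩ := h.1 b hb q hq
    exact ⟨q', h1, r, σ, h2, h3, hTT _ _ _ _ h2 hb h4⟩
  · obtain ⟨q', h4, b, h5, h6⟩ := h.2 r σ h1 q h2 h3
    exact ⟨q', h4, b, h5, hTT _ _ _ _ h1 h5 h6⟩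

theorem fo_iff (hT : IsTransitiveSet A) (hZ : SatZFC A id) {Q R p τ a : ↥A} :
    Fo hZ Q R p τ a ↔ p.1 ∈ Q.1 ∧ Stp hZ R (Fo hZ Q R) p τ a := by
  constructor
  · rintro ⟨X, hX, h⟩
    obtain ⟨h1, h2⟩ := hX _ _ _ h
    exact ⟨h1, h2.mono fun q r σ b _ _ h => ⟨X, hX, h⟩⟩
  · rintro ⟨hp, hs⟩
    obtain ⟨U, hU, hUm⟩ := tcA hT hZ (upA hZ τ a)
    have hτU : τ.1 ∈ U.1 := hU _ hUm _ ((mem_upA _ _ _ _).2 (Or.inl rfl))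
    have haU : a.1 ∈ U.1 := hU _ hUm _ ((mem_upA _ _ _ _).2 (Or.inr rfl))
    obtain ⟨P1, hP1⟩ := prodA hT hZ U U
    obtain ⟨P2, hP2⟩ := prodA hT hZ Q P1
    have hd : Dfb (α := Fin 1) A Set.univ (fun v => ∃ p τ a : ↥A,
        v 0 = prA hZ p (prA hZ τ a) ∧ τ.1 ∈ U.1 ∧ a.1 ∈ U.1 ∧ Fo hZ Q R p τ a) := by
      refine Dfb.congr (P := fun v : Fin 1 → ↥A => ∃ p τ a w : ↥A, w = prA hZ τ a ∧
        v 0 = prA hZ p w ∧ τ.1 ∈ U.1 ∧ a.1 ∈ U.1 ∧ Fo hZ Q R p τ a) ?_ (fun v => by simp)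
      repeat' first
        | with_reducible exact Tm.var _
        | with_reducible exact Tm.const (Set.mem_univ _)
        | with_reducible apply Dfb.fo hT hZ (Set.mem_univ _) (Set.mem_univ _)
        | with_reducible apply Dfb.isPr hT
        | with_reducible apply Dfb.mem
        | with_reducible apply Dfb.and
        | with_reducible apply Dfb.ex
    obtain ⟨X, hX⟩ := sepA hZ (P := fun z => ∃ p τ a : ↥A,
        z = prA hZ p (prA hZ τ a) ∧ τ.1 ∈ U.1 ∧ a.1 ∈ U.1 ∧ Fo hZ Q R p τ a) hd P2
    have hX' : ∀ p τ a : ↥A, (prA hZ p (prA hZ τ a)).1 ∈ X.1 ↔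
        τ.1 ∈ U.1 ∧ a.1 ∈ U.1 ∧ Fo hZ Q R p τ a := by
      intro p τ a
      rw [hX]
      constructor
      · rintro ⟨-, p', τ', a', he, h⟩
        obtain ⟨rfl, he'⟩ := prA_inj hZ he
        obtain ⟨rfl, rfl⟩ := prA_inj hZ he'
        exact h
      · rintro ⟨h1, h2, h3⟩
        refine ⟨hP2 _ _ ?_ (hP1 _ _ h1 h2), p, τ, a, rfl, h1, h2, h3⟩
        obtain ⟨Y, hY, h⟩ := h3
        exact (hY _ _ _ h).1
    obtain ⟨Y, hY⟩ := insA hT hZ (prA hZ p (prA hZ τ a)) X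
    have key : ∀ p τ a : ↥A, τ.1 ∈ U.1 → a.1 ∈ U.1 → Stp hZ R (Fo hZ Q R) p τ a →
        Stp hZ R (fun p τ a => (prA hZ p (prA hZ τ a)).1 ∈ Y.1) p τ a := by
      intro p τ a h1 h2 h
      refine h.mono fun q r σ b h3 h4 h5 => ?_
      exact (hY _).2 (Or.inr ((hX' _ _ _).2 ⟨hU.pr hZ h1 h3, hU _ h2 _ h4, h5⟩))
    refine ⟨Y, ?_, (hY _).2 (Or.inl rfl)⟩
    intro p' τ' a' h
    rcases (hY _).1 h with he | h
    · obtain ⟨rfl, he'⟩ := prA_inj hZ he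
      obtain ⟨rfl, rfl⟩ := prA_inj hZ he'
      exact ⟨hp, key _ _ _ hτU haU hs⟩
    · obtain ⟨h1, h2, Z, hZZ, h3⟩ := (hX' _ _ _).1 h
      obtain ⟨h4, h5⟩ := hZZ _ _ _ h3
      exact ⟨h4, key _ _ _ h1 h2 (h5.mono fun q r σ b _ _ h => ⟨Z, hZZ, h⟩)⟩

theorem fo_unique (hT : IsTransitiveSet A) (hZ : SatZFC A id) {Q R : ↥A}
    (hQR : IsForcingPoset Q.1 R.1) (a : ↥A) : ∀ p p' q τ b : ↥A, Fo hZ Q R p τ a →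
    Fo hZ Q R p' τ b → (prA hZ q p).1 ∈ R.1 → (prA hZ q p').1 ∈ R.1 → a = b := by
  have tr : ∀ {x y z : ↥A}, (prA hZ x y).1 ∈ R.1 → (prA hZ y z).1 ∈ R.1 →
    (prA hZ x z).1 ∈ R.1 := fun h h' => hQR.trans _ _ _ h h'
  have rf : ∀ {x y : ↥A}, (prA hZ x y).1 ∈ R.1 → (prA hZ x x).1 ∈ R.1 := by
    intro x y h
    exact hQR.refl _ (ZFSet.pair_mem_prod.1 (hQR.sub h)).1
  induction a using indA hT with
  | h a ih =>
  intro p p' q τ b h1 h2 h3 h4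
  obtain ⟨-, h1⟩ := (fo_iff hT hZ).1 h1
  obtain ⟨-, h2⟩ := (fo_iff hT hZ).1 h2
  refine extA hT fun c => ⟨fun hc => ?_, fun hc => ?_⟩
  · obtain ⟨q1, h5, r, σ, h6, h7, h8⟩ := h1.1 c hc q h3
    obtain ⟨q2, h9, d, hd, h10⟩ := h2.2 r σ h6 q1 (tr h5 h4) h7
    rw [ih c hc q1 q2 q2 σ d h8 h10 h9 (rf h9)]
    exact hd
  · obtain ⟨q1, h5, r, σ, h6, h7, h8⟩ := h2.1 c hc q h4
    obtain ⟨q2, h9, d, hd, h10⟩ := h1.2 r σ h6 q1 (tr h5 h3) h7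
    rw [← ih d hd q2 q1 q2 σ c h10 h8 (rf h9) h9]
    exact hd

theorem mem_val {G : Set ZFSet.{u}} {τ z : ZFSet.{u}} :
    z ∈ val G τ ↔ ∃ p ∈ G, ∃ σ, ZFSet.pair p σ ∈ τ ∧ z = val G σ := by
  have hpr : ∀ {p σ : ZFSet.{u}}, ZFSet.pair p σ ∈ τ →
      σ ∈ ZFSet.sUnion (ZFSet.sUnion τ) ∧ σ.rank < τ.rank := by
    intro p σ h
    have h1 : ({p, σ} : ZFSet) ∈ ZFSet.pair p σ := by simp [ZFSet.pair]
    have h2 : σ ∈ ({p, σ} : ZFSet) := by simp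
    refine ⟨ZFSet.mem_sUnion.2 ⟨_, ZFSet.mem_sUnion.2 ⟨_, h, h1⟩, h2⟩, ?_⟩
    exact (ZFSet.rank_lt_of_mem h2).trans
      ((ZFSet.rank_lt_of_mem h1).trans (ZFSet.rank_lt_of_mem h))
  unfold val
  rw [WellFounded.fix_eq]
  rw [@ZFSet.mem_image _ (Classical.allZFSetDefinable _)]
  simp only [ZFSet.mem_sep]
  constructor
  · rintro ⟨σ, ⟨h1, p, hp, h⟩, rfl⟩
    refine ⟨p, hp, σ, h, ?_⟩
    rw [dif_pos (hpr h).2]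
  · rintro ⟨p, hp, σ, h, rfl⟩
    refine ⟨σ, ⟨(hpr h).1, p, hp, h⟩, ?_⟩
    rw [dif_pos (hpr h).2]

theorem isName_iff {Q τ : ZFSet.{u}} :
    IsName Q τ ↔ ∀ x ∈ τ, ∃ p σ, p ∈ Q ∧ x = ZFSet.pair p σ ∧ IsName Q σ := by
  have hpr : ∀ {p σ : ZFSet.{u}}, ZFSet.pair p σ ∈ τ → σ.rank < τ.rank := by
    intro p σ h
    have h1 : ({p, σ} : ZFSet) ∈ ZFSet.pair p σ := by simp [ZFSet.pair]
    have h2 : σ ∈ ({p, σ} : ZFSet) := by simp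
    exact (ZFSet.rank_lt_of_mem h2).trans
      ((ZFSet.rank_lt_of_mem h1).trans (ZFSet.rank_lt_of_mem h))
  unfold IsName
  rw [WellFounded.fix_eq]
  constructor
  · intro h x hx
    obtain ⟨p, σ, hp, he, _, h'⟩ := h x hx
    exact ⟨p, σ, hp, he, h'⟩
  · intro h x hx
    obtain ⟨p, σ, hp, he, h'⟩ := h x hx
    exact ⟨p, σ, hp, he, hpr (p := p) (he ▸ hx), h'⟩

theorem mem_valA (hT : IsTransitiveSet A) (hZ : SatZFC A id) {G : Set ZFSet.{u}} {Q R : ↥A}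
    (hG : IsGenericFilter A Q.1 R.1 G) {τ : ↥A} {z : ZFSet.{u}} :
    z ∈ val G τ.1 ↔ ∃ p σ : ↥A, p.1 ∈ G ∧ (prA hZ p σ).1 ∈ τ.1 ∧ z = val G σ.1 := by
  rw [mem_val]
  constructor
  · rintro ⟨p, hp, σ, h, hz⟩
    have h1 : ({p, σ} : ZFSet) ∈ ZFSet.pair p σ := by simp [ZFSet.pair]
    have h2 : σ ∈ ({p, σ} : ZFSet) := by simp
    exact ⟨⟨p, hT _ Q.2 _ (hG.sub hp)⟩, ⟨σ, hT _ (hT _ (hT _ τ.2 _ h) _ h1) _ h2⟩, hp, h, hz⟩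
  · rintro ⟨p, σ, hp, h, hz⟩
    exact ⟨p.1, hp, σ.1, h, hz⟩

/-- Genericity for definable dense classes of conditions. -/
theorem gen (hZ : SatZFC A id) {G : Set ZFSet.{u}} {Q R : ↥A}
    (hT : IsTransitiveSet A)
    (hG : IsGenericFilter A Q.1 R.1 G) (hQR : IsForcingPoset Q.1 R.1) {P : ↥A → Prop}
    (h : Dfb (α := Fin 1) A Set.univ (fun v => P (v 0)))
    (hD : ∀ q : ↥A, q.1 ∈ Q.1 → ∃ q' : ↥A, (prA hZ q' q).1 ∈ R.1 ∧ P q') :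
    ∃ g : ↥A, g.1 ∈ G ∧ P g := by
  obtain ⟨D, hD'⟩ := sepA hZ h Q
  have hdense : DenseIn Q.1 R.1 D.1 := by
    constructor
    · intro x hx
      exact ((hD' ⟨x, hT _ D.2 _ hx⟩).1 hx).1
    · intro p hp
      obtain ⟨q', h1, h2⟩ := hD ⟨p, hT _ Q.2 _ hp⟩ hp
      exact ⟨q'.1, (hD' q').2 ⟨(ZFSet.pair_mem_prod.1 (hQR.sub h1)).1, h2⟩, h1⟩
  obtain ⟨g, hg, hgD⟩ := hG.generic D.1 D.2 hdense
  exact ⟨⟨g, hT _ Q.2 _ (hG.sub hg)⟩, hg, ((hD' ⟨g, hT _ Q.2 _ (hG.sub hg)⟩).1 hgD).2⟩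

theorem dir (hZ : SatZFC A id) {G : Set ZFSet.{u}} {Q R : ↥A} (hT : IsTransitiveSet A)
    (hG : IsGenericFilter A Q.1 R.1 G) {p q : ↥A} (hp : p.1 ∈ G) (hq : q.1 ∈ G) :
    ∃ r : ↥A, r.1 ∈ G ∧ (prA hZ r p).1 ∈ R.1 ∧ (prA hZ r q).1 ∈ R.1 := by
  obtain ⟨r, h1, h2, h3⟩ := hG.directed _ hp _ hq
  exact ⟨⟨r, hT _ Q.2 _ (hG.sub h1)⟩, h1, h2, h3⟩

theorem upw (hZ : SatZFC A id) {G : Set ZFSet.{u}} {Q R : ↥A}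
    (hG : IsGenericFilter A Q.1 R.1 G) (hQR : IsForcingPoset Q.1 R.1)
    {p q : ↥A} (hp : p.1 ∈ G) (h : (prA hZ p q).1 ∈ R.1) : q.1 ∈ G :=
  hG.upward _ hp _ (ZFSet.pair_mem_prod.1 (hQR.sub h)).2 h

/-- Genericity below a condition. -/
theorem genBelow (hZ : SatZFC A id) {G : Set ZFSet.{u}} {Q R : ↥A}
    (hT : IsTransitiveSet A)
    (hG : IsGenericFilter A Q.1 R.1 G) (hQR : IsForcingPoset Q.1 R.1) {P : ↥A → Prop}
    (h : Dfb (α := Fin 1) A Set.univ (fun v => P (v 0))) {p : ↥A} (hp : p.1 ∈ G)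
    (hD : ∀ q : ↥A, (prA hZ q p).1 ∈ R.1 → ∃ q' : ↥A, (prA hZ q' q).1 ∈ R.1 ∧ P q') :
    ∃ g : ↥A, g.1 ∈ G ∧ P g := by
  obtain ⟨g, hg, hg'⟩ := gen hZ hT hG hQR (P := fun z => P z ∨
    ¬ ∃ w : ↥A, (prA hZ w z).1 ∈ R.1 ∧ (prA hZ w p).1 ∈ R.1) (by
      refine Dfb.or h (Dfb.not (Dfb.ex (Dfb.and ?_ ?_)))
      · exact Dfb.prmem hT hZ (Tm.var _) (Tm.var _) (Tm.const (Set.mem_univ _))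
      · exact Dfb.prmem hT hZ (Tm.var _) (Tm.const (Set.mem_univ _))
          (Tm.const (Set.mem_univ _))) (by
      intro q hq
      by_cases hw : ∃ w : ↥A, (prA hZ w q).1 ∈ R.1 ∧ (prA hZ w p).1 ∈ R.1
      · obtain ⟨w, h1, h2⟩ := hw
        obtain ⟨q', h3, h4⟩ := hD w h2
        exact ⟨q', hQR.trans _ _ _ h3 h1, Or.inl h4⟩
      · exact ⟨q, hQR.refl _ hq, Or.inr hw⟩)
  rcases hg' with hg' | hg'
  · exact ⟨g, hg, hg'⟩
  · obtain ⟨r, -, h1, h2⟩ := dir hZ hT hG hg hp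
    exact absurd ⟨r, h1, h2⟩ hg'

theorem fo_sound (hZ : SatZFC A id) {G : Set ZFSet.{u}} {Q R : ↥A}
    (hT : IsTransitiveSet A)
    (hG : IsGenericFilter A Q.1 R.1 G) (hQR : IsForcingPoset Q.1 R.1) (a : ↥A) :
    ∀ p τ : ↥A, p.1 ∈ G → Fo hZ Q R p τ a → val G τ.1 = a.1 := by
  induction a using indA hT with
  | h a ih =>
  intro p τ hp hf
  obtain ⟨-, h1, h2⟩ := (fo_iff hT hZ).1 hf
  ext z
  rw [mem_valA hT hZ hG]
  constructor
  · rintro ⟨r, σ, hr, hrσ, rfl⟩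
    obtain ⟨q, hq, hqp, hqr⟩ := dir hZ hT hG hp hr
    obtain ⟨g, hg, b, hb, hgb⟩ := genBelow hZ hT hG hQR
      (P := fun z => ∃ b : ↥A, b.1 ∈ a.1 ∧ Fo hZ Q R z σ b) (p := q) (by
        refine Dfb.ex (Dfb.and (Dfb.mem (Tm.var _) (Tm.const (Set.mem_univ _))) ?_)
        exact Dfb.fo hT hZ (Set.mem_univ _) (Set.mem_univ _) (Tm.var _)
          (Tm.const (Set.mem_univ _)) (Tm.var _)) hq (by
        intro q' hq'
        exact h2 r σ hrσ q' (hQR.trans _ _ _ hq' hqp) (hQR.trans _ _ _ hq' hqr))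
    rw [ih b hb g σ hg hgb]
    exact hb
  · intro hz
    have hzA : z ∈ A := hT _ a.2 _ hz
    obtain ⟨g, hg, r, σ, h3, h4, h5⟩ := genBelow hZ hT hG hQR
      (P := fun w => ∃ r σ : ↥A, (prA hZ r σ).1 ∈ τ.1 ∧
      (prA hZ w r).1 ∈ R.1 ∧ Fo hZ Q R w σ ⟨z, hzA⟩) (p := p) (by
        repeat' first
          | with_reducible exact Tm.var _
          | with_reducible exact Tm.const (Set.mem_univ _)
          | with_reducible apply Dfb.fo hT hZ (Set.mem_univ _) (Set.mem_univ _)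
          | with_reducible apply Dfb.prmem hT
          | with_reducible apply Dfb.and
          | with_reducible apply Dfb.ex) hp (h1 ⟨z, hzA⟩ hz)
    exact ⟨r, σ, upw hZ hG hQR hg h4, h3, (ih ⟨z, hzA⟩ hz g σ hg h5).symm⟩

theorem fo_mono (hT : IsTransitiveSet A) (hZ : SatZFC A id) {Q R p q τ a : ↥A}
    (hQR : IsForcingPoset Q.1 R.1)
    (h : Fo hZ Q R p τ a) (hq : (prA hZ q p).1 ∈ R.1) : Fo hZ Q R q τ a := by
  rw [fo_iff hT hZ] at h ⊢
  refine ⟨(ZFSet.pair_mem_prod.1 (hQR.sub hq)).1, ?_, ?_⟩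
  · intro b hb q' hq'
    exact h.2.1 b hb q' (hQR.trans _ _ _ hq' hq)
  · intro r σ h1 q' hq'
    exact h.2.2 r σ h1 q' (hQR.trans _ _ _ hq' hq)

theorem fo_complete (hZ : SatZFC A id) {G : Set ZFSet.{u}} {Q R : ↥A}
    (hT : IsTransitiveSet A)
    (hG : IsGenericFilter A Q.1 R.1 G) (hQR : IsForcingPoset Q.1 R.1) (a : ↥A) :
    ∀ τ : ↥A, val G τ.1 = a.1 → ∃ p : ↥A, p.1 ∈ G ∧ Fo hZ Q R p τ a := by
  induction a using indA hT with
  | h a ih =>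
  intro τ hv
  obtain ⟨p, hp, h⟩ := gen hZ hT hG hQR (P := fun p => Fo hZ Q R p τ a ∨
    (∃ b : ↥A, b.1 ∈ a.1 ∧ ∀ q : ↥A, (prA hZ q p).1 ∈ R.1 → ∀ r σ : ↥A,
      (prA hZ r σ).1 ∈ τ.1 → (prA hZ q r).1 ∈ R.1 → ¬ Fo hZ Q R q σ b) ∨
    (∃ r σ : ↥A, (prA hZ r σ).1 ∈ τ.1 ∧ (prA hZ p r).1 ∈ R.1 ∧
      ∀ q : ↥A, (prA hZ q p).1 ∈ R.1 → ∀ b : ↥A, b.1 ∈ a.1 → ¬ Fo hZ Q R q σ b)) (by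
      repeat' first
          | with_reducible exact Tm.var _
          | with_reducible exact Tm.const (Set.mem_univ _)
          | with_reducible apply Dfb.fo hT hZ (Set.mem_univ _) (Set.mem_univ _)
          | with_reducible apply Dfb.prmem hT
          | with_reducible apply Dfb.mem
          | with_reducible apply Dfb.and
          | with_reducible apply Dfb.or
          | with_reducible apply Dfb.ex
          | with_reducible apply Dfb.all
          | with_reducible apply Dfb.not
          | with_reducible apply Dfb.imp) (by
      intro p hp
      by_contra hcon
      push Not at hcon
      have hself := (hcon p (hQR.refl _ hp)).1
      apply hself
      rw [fo_iff hT hZ]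
      refine ⟨hp, ?_, ?_⟩
      · intro b hb q hq
        obtain ⟨q', h1, r, σ, h2, h3, h4⟩ := (hcon q hq).2.1 b hb
        exact ⟨q', h1, r, σ, h2, h3, h4⟩
      · intro r σ h1 q h2 h3
        obtain ⟨q', h4, b, h5, h6⟩ := (hcon q h2).2.2 r σ h1 h3
        exact ⟨q', h4, b, h5, h6⟩)
  rcases h with h | ⟨b, hb, h⟩ | ⟨r, σ, h1, h2, h⟩
  · exact ⟨p, hp, h⟩
  · exfalso
    have hb' : b.1 ∈ val G τ.1 := hv ▸ hb
    obtain ⟨r, σ, hr, hrσ, he⟩ := (mem_valA hT hZ hG).1 hb'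
    obtain ⟨q, hq, hf⟩ := ih b hb σ he.symm
    obtain ⟨c, hc, hcp, hcr⟩ := dir hZ hT hG hp hr
    obtain ⟨d, hd, hdc, hdq⟩ := dir hZ hT hG hc hq
    exact h d (hQR.trans _ _ _ hdc hcp) r σ hrσ (hQR.trans _ _ _ hdc hcr)
      (fo_mono hT hZ hQR hf hdq)
  · exfalso
    have hr := upw hZ hG hQR hp h2
    have hs : val G σ.1 ∈ a.1 := hv ▸ (mem_valA hT hZ hG).2 ⟨r, σ, hr, h1, rfl⟩
    obtain ⟨q, hq, hf⟩ := ih ⟨_, hT _ a.2 _ hs⟩ hs σ rfl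
    obtain ⟨d, hd, hdp, hdq⟩ := dir hZ hT hG hp hq
    exact h d hdp _ hs (fo_mono hT hZ hQR hf hdq)

end forcing

end Paper

namespace Paper

universe u

section names

variable {A : Set ZFSet.{u}} {B : Set ZFSet.{u}} {α : Type}

/-- All members of `H` are sets of pairs of a condition and a member of `H`. -/
def NAtt (hZ : SatZFC A id) (Q H : ↥A) : Prop :=
  ∀ b : ↥A, b.1 ∈ H.1 → ∀ x : ↥A, x.1 ∈ b.1 → ∃ p π : ↥A, p.1 ∈ Q.1 ∧ π.1 ∈ H.1 ∧ x = prA hZ p π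

/-- Names, internally. -/
def Nm (hZ : SatZFC A id) (Q a : ↥A) : Prop := ∃ H : ↥A, NAtt hZ Q H ∧ a.1 ∈ H.1

theorem Dfb.nm (hT : IsTransitiveSet A) (hZ : SatZFC A id) {Q : ↥A} (hQ : Q.1 ∈ B)
    {t : (α → ↥A) → ↥A} (ht : Tm B t) : Dfb A B (fun v => Nm hZ Q (t v)) := by
  refine Dfb.sub1 (P := fun x => Nm hZ Q x) ?_ ht
  unfold Nm NAtt
  repeat' first
    | with_reducible exact Tm.var _
    | with_reducible exact Tm.const hQ
    | with_reducible apply Dfb.isPr hT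
    | with_reducible apply Dfb.mem
    | with_reducible apply Dfb.and
    | with_reducible apply Dfb.ex
    | with_reducible apply Dfb.all
    | with_reducible apply Dfb.imp

theorem nm_sound (hT : IsTransitiveSet A) (hZ : SatZFC A id) {Q a : ↥A} (h : Nm hZ Q a) :
    IsName Q.1 a.1 := by
  obtain ⟨H, hH, ha⟩ := h
  have key : ∀ (x : ZFSet.{u}) (hx : x ∈ A), x ∈ H.1 → IsName Q.1 x := by
    intro x
    refine rankWf.induction (C := fun x => ∀ (hx : x ∈ A), x ∈ H.1 → IsName Q.1 x) x ?_
    intro x ih hx hxH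
    rw [isName_iff]
    intro y hy
    obtain ⟨p, π, hp, hπ, he⟩ := hH ⟨x, hx⟩ hxH ⟨y, hT _ hx _ hy⟩ hy
    have he' : y = ZFSet.pair p.1 π.1 := congrArg Subtype.val he
    refine ⟨p.1, π.1, hp, he', ih _ ?_ π.2 hπ⟩
    have h1 : ({p.1, π.1} : ZFSet) ∈ ZFSet.pair p.1 π.1 := by simp [ZFSet.pair]
    have h2 : π.1 ∈ ({p.1, π.1} : ZFSet) := by simp
    exact (ZFSet.rank_lt_of_mem h2).trans
      ((ZFSet.rank_lt_of_mem h1).trans (ZFSet.rank_lt_of_mem (he' ▸ hy)))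
  exact key _ a.2 ha

theorem nm_complete (hT : IsTransitiveSet A) (hZ : SatZFC A id) {Q a : ↥A}
    (h : IsName Q.1 a.1) : Nm hZ Q a := by
  obtain ⟨U, hU, haU⟩ := tcA hT hZ a
  obtain ⟨H, hH⟩ := sepA hZ (P := fun z => Nm hZ Q z)
    (Dfb.nm hT hZ (Set.mem_univ _) (Tm.var _)) U
  have key : ∀ (x : ZFSet.{u}) (hx : x ∈ A), x ∈ U.1 → IsName Q.1 x → Nm hZ Q ⟨x, hx⟩ := by
    intro x
    refine rankWf.induction (C := fun x => ∀ (hx : x ∈ A), x ∈ U.1 → IsName Q.1 x →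
      Nm hZ Q ⟨x, hx⟩) x ?_
    intro x ih hx hxU hn
    rw [isName_iff] at hn
    obtain ⟨K, hK⟩ := insA hT hZ ⟨x, hx⟩ H
    refine ⟨K, ?_, (hK _).2 (Or.inl rfl)⟩
    intro b hb y hy
    rcases (hK b).1 hb with rfl | hb
    · obtain ⟨p, π, hp, he, hπ⟩ := hn y.1 hy
      have h1 : ({p, π} : ZFSet) ∈ ZFSet.pair p π := by simp [ZFSet.pair]
      have h2 : π ∈ ({p, π} : ZFSet) := by simp
      have hpA : p ∈ A := hT _ Q.2 _ hp
      have hπA : π ∈ A := hT _ (hT _ (he ▸ y.2) _ h1) _ h2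
      have hrk : π.rank < x.rank := (ZFSet.rank_lt_of_mem h2).trans
        ((ZFSet.rank_lt_of_mem h1).trans (ZFSet.rank_lt_of_mem (he ▸ hy)))
      have hyp : y = prA hZ ⟨p, hpA⟩ ⟨π, hπA⟩ := Subtype.ext he
      have hπU : π ∈ U.1 := hU.pr hZ (x := ⟨p, hpA⟩) (y := ⟨π, hπA⟩) (τ := ⟨x, hx⟩) hxU
        (hyp ▸ hy)
      exact ⟨⟨p, hpA⟩, ⟨π, hπA⟩, hp,
        (hK _).2 (Or.inr ((hH ⟨π, hπA⟩).2 ⟨hπU, ih π hrk hπA hπU hπ⟩)), hyp⟩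
    · obtain ⟨hbU, K', hK', hbK'⟩ := (hH b).1 hb
      obtain ⟨p, π, hp, hπ, rfl⟩ := hK' b hbK' y hy
      exact ⟨p, π, hp, (hK _).2 (Or.inr ((hH _).2 ⟨hU.pr hZ hbU hy, K', hK', hπ⟩)), rfl⟩
  exact key _ a.2 haU h

/-- `X` is a set of pairs `(x, x̌)` justified by the recursion for check names. -/
def CAtt (hZ : SatZFC A id) (Q X : ↥A) : Prop :=
  ∀ x s : ↥A, (prA hZ x s).1 ∈ X.1 →
    (∀ y : ↥A, y.1 ∈ x.1 → ∃ t : ↥A, (prA hZ y t).1 ∈ X.1) ∧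
    ∀ w : ↥A, w.1 ∈ s.1 ↔ ∃ p y t : ↥A, p.1 ∈ Q.1 ∧ y.1 ∈ x.1 ∧ (prA hZ y t).1 ∈ X.1 ∧
      w = prA hZ p t

/-- `s` is the check name of `x`. -/
def Ck (hZ : SatZFC A id) (Q x s : ↥A) : Prop :=
  ∃ X : ↥A, CAtt hZ Q X ∧ (prA hZ x s).1 ∈ X.1

theorem Dfb.ck (hT : IsTransitiveSet A) (hZ : SatZFC A id) {Q : ↥A} (hQ : Q.1 ∈ B)
    {t s : (α → ↥A) → ↥A} (ht : Tm B t) (hs : Tm B s) :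
    Dfb A B (fun v => Ck hZ Q (t v) (s v)) := by
  refine Dfb.sub2 (P := fun x y => Ck hZ Q x y) ?_ ht hs
  unfold Ck CAtt
  repeat' first
    | with_reducible exact Tm.var _
    | with_reducible exact Tm.const hQ
    | with_reducible apply Dfb.isPr hT
    | with_reducible apply Dfb.prmem hT
    | with_reducible apply Dfb.mem
    | with_reducible apply Dfb.and
    | with_reducible apply Dfb.ex
    | with_reducible apply Dfb.all
    | with_reducible apply Dfb.iff
    | with_reducible apply Dfb.imp

theorem ck_unique (hT : IsTransitiveSet A) (hZ : SatZFC A id) {Q : ↥A} (x : ↥A) :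
    ∀ s s' : ↥A, Ck hZ Q x s → Ck hZ Q x s' → s = s' := by
  induction x using indA hT with
  | h x ih =>
  have half : ∀ s s' : ↥A, Ck hZ Q x s → Ck hZ Q x s' → ∀ w : ↥A, w.1 ∈ s.1 → w.1 ∈ s'.1 := by
    rintro s s' ⟨X, hX, h⟩ ⟨X', hX', h'⟩ w hw
    obtain ⟨p, y, t, hp, hy, ht, rfl⟩ := ((hX _ _ h).2 w).1 hw
    obtain ⟨t', ht'⟩ := (hX' _ _ h').1 y hy
    have := ih y hy t t' ⟨X, hX, ht⟩ ⟨X', hX', ht'⟩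
    subst this
    exact ((hX' _ _ h').2 _).2 ⟨p, y, t, hp, hy, ht', rfl⟩
  intro s s' h h'
  exact extA hT fun w => ⟨half _ _ h h' w, half _ _ h' h w⟩

theorem ck_sound (hT : IsTransitiveSet A) (hZ : SatZFC A id) {G : Set ZFSet.{u}} {Q R : ↥A}
    (hG : IsGenericFilter A Q.1 R.1 G) (x : ↥A) :
    ∀ s : ↥A, Ck hZ Q x s → IsName Q.1 s.1 ∧ val G s.1 = x.1 := by
  induction x using indA hT with
  | h x ih =>
  rintro s ⟨X, hX, h⟩
  obtain ⟨h1, h2⟩ := hX _ _ h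
  constructor
  · rw [isName_iff]
    intro w hw
    obtain ⟨p, y, t, hp, hy, ht, he⟩ := (h2 ⟨w, hT _ s.2 _ hw⟩).1 hw
    exact ⟨p.1, t.1, hp, congrArg Subtype.val he, (ih y hy t ⟨X, hX, ht⟩).1⟩
  · ext z
    rw [mem_valA hT hZ hG]
    constructor
    · rintro ⟨q, σ, hq, hqσ, rfl⟩
      obtain ⟨p, y, t, hp, hy, ht, he⟩ := (h2 _).1 hqσ
      obtain ⟨rfl, rfl⟩ := prA_inj hZ he
      rw [(ih y hy _ ⟨X, hX, ht⟩).2]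
      exact hy
    · intro hz
      obtain ⟨t, ht⟩ := h1 ⟨z, hT _ x.2 _ hz⟩ hz
      obtain ⟨g, hg⟩ := hG.nonempty
      have hgQ := hG.sub hg
      exact ⟨⟨g, hT _ Q.2 _ hgQ⟩, t, hg, (h2 _).2 ⟨_, _, t, hgQ, hz, ht, rfl⟩,
        (ih ⟨z, hT _ x.2 _ hz⟩ hz t ⟨X, hX, ht⟩).2.symm⟩

theorem ck_ex (hT : IsTransitiveSet A) (hZ : SatZFC A id) (Q x₀ : ↥A) :
    ∃ s : ↥A, Ck hZ Q x₀ s := by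
  obtain ⟨U, hU, hxU⟩ := tcA hT hZ x₀
  obtain ⟨X, hX⟩ := repA hZ (P := fun y w => ∃ s : ↥A, w = prA hZ y s ∧ Ck hZ Q y s) (by
    refine Dfb.ex (Dfb.and (Dfb.isPr hT hZ (Tm.var _) (Tm.var _) (Tm.var _)) ?_)
    exact Dfb.ck hT hZ (Set.mem_univ _) (Tm.var _) (Tm.var _)) U (by
    rintro z w w' - ⟨s, rfl, hs⟩ ⟨s', rfl, hs'⟩
    rw [ck_unique hT hZ z s s' hs hs'])
  have hX' : ∀ y s : ↥A, (prA hZ y s).1 ∈ X.1 ↔ y.1 ∈ U.1 ∧ Ck hZ Q y s := by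
    intro y s
    rw [hX]
    constructor
    · rintro ⟨z, hz, s', he, h⟩
      obtain ⟨rfl, rfl⟩ := prA_inj hZ he
      exact ⟨hz, h⟩
    · rintro ⟨h1, h2⟩
      exact ⟨y, h1, s, rfl, h2⟩
  have key : ∀ x : ↥A, x.1 ∈ U.1 → ∃ s : ↥A, Ck hZ Q x s := by
    intro x
    induction x using indA hT with
    | h x ih =>
    intro hx
    obtain ⟨P, hP⟩ := prodA hT hZ Q (unA hZ (unA hZ X))
    obtain ⟨s, hs⟩ := sepA hZ (P := fun w => ∃ p y t : ↥A, p.1 ∈ Q.1 ∧ y.1 ∈ x.1 ∧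
      (prA hZ y t).1 ∈ X.1 ∧ w = prA hZ p t) (by
      repeat' first
        | with_reducible exact Tm.var _
        | with_reducible exact Tm.const (Set.mem_univ _)
        | with_reducible apply Dfb.isPr hT
        | with_reducible apply Dfb.prmem hT
        | with_reducible apply Dfb.mem
        | with_reducible apply Dfb.and
        | with_reducible apply Dfb.ex) P
    have hs' : ∀ w : ↥A, w.1 ∈ s.1 ↔ ∃ p y t : ↥A, p.1 ∈ Q.1 ∧ y.1 ∈ x.1 ∧
        (prA hZ y t).1 ∈ X.1 ∧ w = prA hZ p t := by
      intro w
      rw [hs]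
      refine ⟨fun h => h.2, fun h => ⟨?_, h⟩⟩
      obtain ⟨p, y, t, hp, hy, ht, rfl⟩ := h
      exact hP _ _ hp (snd_mem hZ ht)
    obtain ⟨Y, hY⟩ := insA hT hZ (prA hZ x s) X
    have hXY : ∀ y t : ↥A, (prA hZ y t).1 ∈ X.1 → (prA hZ y t).1 ∈ Y.1 :=
      fun y t h => (hY _).2 (Or.inr h)
    have hYX : ∀ y t : ↥A, y ≠ x → (prA hZ y t).1 ∈ Y.1 → (prA hZ y t).1 ∈ X.1 := by
      intro y t hne h
      rcases (hY _).1 h with he | h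
      · exact absurd (prA_inj hZ he).1 hne
      · exact h
    by_cases hxs : ∃ s, Ck hZ Q x s
    · exact hxs
    refine ⟨s, Y, ?_, (hY _).2 (Or.inl rfl)⟩
    have hmemne : ∀ y z : ↥A, y.1 ∈ z.1 → (∃ s, Ck hZ Q y s) → y ≠ x := by
      rintro y z - h rfl
      exact hxs h
    have hYX' : ∀ y t : ↥A, (∃ s, Ck hZ Q y s) →
        ((prA hZ y t).1 ∈ Y.1 ↔ (prA hZ y t).1 ∈ X.1) :=
      fun y t h => ⟨hYX y t (fun e => hxs (e ▸ h)), hXY y t⟩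
    intro y t ht
    rcases (hY _).1 ht with he | h
    · obtain ⟨rfl, rfl⟩ := prA_inj hZ he
      have hyy : ∀ z : ↥A, z.1 ∈ y.1 → ∃ s, Ck hZ Q z s :=
        fun z hz => ih z hz (hU _ hx _ hz)
      constructor
      · intro z hz
        obtain ⟨c, hc⟩ := hyy z hz
        exact ⟨c, hXY _ _ ((hX' _ _).2 ⟨hU _ hx _ hz, hc⟩)⟩
      · intro w
        rw [hs']
        constructor
        · rintro ⟨p, z, c, h1, h2, h3, h4⟩
          exact ⟨p, z, c, h1, h2, hXY _ _ h3, h4⟩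
        · rintro ⟨p, z, c, h1, h2, h3, h4⟩
          exact ⟨p, z, c, h1, h2, (hYX' _ _ (hyy z h2)).1 h3, h4⟩
    · obtain ⟨hyU, Z, hZZ, hyZ⟩ := (hX' _ _).1 h
      obtain ⟨h1, h2⟩ := hZZ _ _ hyZ
      have hyy : ∀ z : ↥A, z.1 ∈ y.1 → ∃ s, Ck hZ Q z s := by
        intro z hz
        obtain ⟨c, hc⟩ := h1 z hz
        exact ⟨c, Z, hZZ, hc⟩
      have hZY : ∀ z c : ↥A, z.1 ∈ y.1 → ((prA hZ z c).1 ∈ Z.1 ↔ (prA hZ z c).1 ∈ Y.1) := by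
        intro z c hz
        rw [hYX' _ _ (hyy z hz), hX']
        constructor
        · intro h
          exact ⟨hU _ hyU _ hz, Z, hZZ, h⟩
        · rintro ⟨-, hc⟩
          obtain ⟨d, hd⟩ := h1 z hz
          rw [ck_unique hT hZ z c d hc ⟨Z, hZZ, hd⟩]
          exact hd
      constructor
      · intro z hz
        obtain ⟨c, hc⟩ := h1 z hz
        exact ⟨c, (hZY _ _ hz).1 hc⟩
      · intro w
        rw [h2]
        constructor
        · rintro ⟨p, z, c, h1, h2, h3, h4⟩
          exact ⟨p, z, c, h1, h2, (hZY _ _ h2).1 h3, h4⟩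
        · rintro ⟨p, z, c, h1, h2, h3, h4⟩
          exact ⟨p, z, c, h1, h2, (hZY _ _ h2).2 h3, h4⟩
  exact key x₀ hxU

/-- The members of the name `σ` with `σ_G = (τ_G)_G`. -/
def Sg (hZ : SatZFC A id) (Q R τ w : ↥A) : Prop :=
  ∃ q π p a r : ↥A, w = prA hZ q π ∧ Fo hZ Q R p τ a ∧ Nm hZ Q a ∧ (prA hZ r π).1 ∈ a.1 ∧
    (prA hZ q p).1 ∈ R.1 ∧ (prA hZ q r).1 ∈ R.1

theorem Dfb.sg (hT : IsTransitiveSet A) (hZ : SatZFC A id) {Q R τ : ↥A} (hQ : Q.1 ∈ B)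
    (hR : R.1 ∈ B) (hτ : τ.1 ∈ B)
    {t : (α → ↥A) → ↥A} (ht : Tm B t) : Dfb A B (fun v => Sg hZ Q R τ (t v)) := by
  refine Dfb.sub1 (P := fun x => Sg hZ Q R τ x) ?_ ht
  unfold Sg
  repeat' first
    | with_reducible exact Tm.var _
    | with_reducible exact Tm.const hQ
    | with_reducible exact Tm.const hR
    | with_reducible exact Tm.const hτ
    | with_reducible apply Dfb.fo hT hZ hQ hR
    | with_reducible apply Dfb.nm hT hZ hQ
    | with_reducible apply Dfb.isPr hT
    | with_reducible apply Dfb.prmem hT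
    | with_reducible apply Dfb.and
    | with_reducible apply Dfb.ex

theorem sg_ex (hT : IsTransitiveSet A) (hZ : SatZFC A id) {Q R : ↥A}
    (hQR : IsForcingPoset Q.1 R.1) (τ : ↥A) :
    ∃ σ : ↥A, ∀ w : ↥A, w.1 ∈ σ.1 ↔ Sg hZ Q R τ w := by
  obtain ⟨b, hb⟩ := repA hZ (P := fun p a => Fo hZ Q R p τ a)
    (Dfb.fo hT hZ (Set.mem_univ _) (Set.mem_univ _) (Tm.var _) (Tm.const (Set.mem_univ _))
      (Tm.var _)) Q (by
    intro p a a' hp h h'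
    exact fo_unique hT hZ hQR a p p p τ a' h h' (hQR.refl _ hp) (hQR.refl _ hp))
  obtain ⟨P, hP⟩ := prodA hT hZ Q (unA hZ (unA hZ (unA hZ b)))
  obtain ⟨σ, hσ⟩ := sepA hZ (P := fun w => Sg hZ Q R τ w)
    (Dfb.sg hT hZ (Set.mem_univ _) (Set.mem_univ _) (Set.mem_univ _) (Tm.var _)) P
  refine ⟨σ, fun w => ?_⟩
  rw [hσ]
  refine ⟨fun h => h.2, fun h => ⟨?_, h⟩⟩
  obtain ⟨q, π, p, a, r, rfl, h1, -, h3, h4, -⟩ := h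
  have hqp := ZFSet.pair_mem_prod.1 (hQR.sub h4)
  exact hP _ _ hqp.1 (snd_mem hZ (mem_unA hZ h3 ((hb a).2 ⟨p, hqp.2, h1⟩)))

end names

end Paper

open Paper in
/-- Lemma 2.2: let `A` be a transitive model of ZFC, `ℚ = (Q, R) ∈ A` a forcing notion,
`M ≺ A` with `ℚ ∈ M`, and `G` an `A`-generic filter on `ℚ`. With
`M[G] = { τ_G : τ ∈ M a ℚ-name }` and `M(G) = M[G] ∩ A`, we have `M(G)[G] = M[G]`. -/
theorem stmt_10 (A : Set ZFSet) (hT : IsTransitiveSet A) (hZ : SatZFC A id)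
    (Q R : ZFSet) (hQR : IsForcingPoset Q R) (hQA : Q ∈ A) (hRA : R ∈ A)
    (M : Set ZFSet) (hM : IsElemSub A id M) (hQM : Q ∈ M) (hRM : R ∈ M)
    (G : Set ZFSet) (hG : IsGenericFilter A Q R G) :
    extModel G Q (extModel G Q M ∩ A) = extModel G Q M := by
  let Q' : ↥A := ⟨Q, hQA⟩
  let R' : ↥A := ⟨R, hRA⟩
  have hG' : IsGenericFilter A Q'.1 R'.1 G := hG
  have hQR' : IsForcingPoset Q'.1 R'.1 := hQR
  ext z
  constructor
  · rintro ⟨s, ⟨⟨τ, hτM, -, hs⟩, hsA⟩, hsN, rfl⟩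
    have hτA := hM.subset hτM
    obtain ⟨σ, hσM, hσ⟩ := elemA hM
      (P := fun σ => ∀ w : ↥A, w.1 ∈ σ.1 ↔ Sg hZ Q' R' ⟨τ, hτA⟩ w)
      (Dfb.all ((Dfb.mem (Tm.var _) (Tm.var _)).iff (Dfb.sg hT hZ hQM hRM hτM (Tm.var _))))
      (sg_ex hT hZ hQR' ⟨τ, hτA⟩)
    obtain ⟨p, hpG, hp⟩ := fo_complete hZ hT hG' hQR' ⟨s, hsA⟩ ⟨τ, hτA⟩ hs.symm
    refine ⟨σ.1, hσM, ?_, ?_⟩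
    · rw [isName_iff]
      intro w hw
      obtain ⟨q, π, p, a, r, he, h1, h2, h3, h4, -⟩ := (hσ ⟨w, hT _ σ.2 _ hw⟩).1 hw
      refine ⟨q.1, π.1, (ZFSet.pair_mem_prod.1 (hQR.sub h4)).1, congrArg Subtype.val he, ?_⟩
      obtain ⟨r', π', -, he', hn⟩ := isName_iff.1 (nm_sound hT hZ h2) _ h3
      rw [(ZFSet.pair_inj.1 he').2]
      exact hn
    · ext x
      rw [mem_valA (τ := σ) hT hZ hG', mem_valA (τ := ⟨s, hsA⟩) hT hZ hG']
      constructor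
      · rintro ⟨r, π, hr, hrπ, rfl⟩
        obtain ⟨q, hq, hqp, hqr⟩ := dir hZ hT hG' hpG hr
        exact ⟨q, π, hq, (hσ _).2 ⟨q, π, p, ⟨s, hsA⟩, r, rfl, hp, nm_complete hT hZ hsN, hrπ,
          hqp, hqr⟩, rfl⟩
      · rintro ⟨q', π', hq, hqπ, rfl⟩
        obtain ⟨q, π, p', a, r, he, h1, h2, h3, h4, h5⟩ := (hσ _).1 hqπ
        obtain ⟨rfl, rfl⟩ := prA_inj hZ he
        have hval := fo_sound hZ hT hG' hQR' a p' ⟨τ, hτA⟩ (upw hZ hG' hQR' hq h4) h1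
        have has : a = ⟨s, hsA⟩ := Subtype.ext (hval.symm.trans hs.symm)
        subst has
        exact ⟨r, _, upw hZ hG' hQR' hq h5, h3, rfl⟩
  · rintro ⟨τ, hτM, hτN, rfl⟩
    have hτA := hM.subset hτM
    obtain ⟨s, hsM, hs⟩ := elemA hM (P := fun s => Ck hZ Q' ⟨τ, hτA⟩ s)
      (Dfb.ck hT hZ hQM (Tm.const hτM) (Tm.var _)) (ck_ex hT hZ Q' ⟨τ, hτA⟩)
    obtain ⟨h1, h2⟩ := ck_sound hT hZ hG' _ s hs
    exact ⟨τ, ⟨⟨s.1, hsM, h1, h2.symm⟩, hτA⟩, hτN, rfl⟩
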